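/- Let ξ ∈ [Φ(1), 1), set q₀ = Φ⁻¹(ξ), and define the tangent coefficients d = 1/(q₀ · φ(q₀)) and b = log q₀ − d·ξ, where φ is the standard Gaussian probability density; here d·ξ + b is the tangent line to log ∘ Φ⁻¹ at ξ, since the derivative of Φ⁻¹ at ξ equals 1/φ(Φ⁻¹(ξ)). Then for every z ∈ [Φ(1), 1), d·z + b ≤ log Φ⁻¹(z). -/

import Mathlib

open MeasureTheory ProbabilityTheory

/-- `Φ`, the cumulative distribution function of the standard Gaussian
distribution `N(0,1)` on `ℝ`. -/
noncomputable def stdGaussianCDF (t : ℝ) : ℝ :=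
  (ProbabilityTheory.gaussianReal 0 1 (Set.Iic t)).toReal

/-- `Φ⁻¹`, the standard Gaussian quantile function (the inverse of `Φ` on `(0,1)`). -/
noncomputable def stdGaussianQuantile : ℝ → ℝ :=
  Function.invFun stdGaussianCDF

theorem stdGaussianCDF_eq_integral (t : ℝ) :
    stdGaussianCDF t = ∫ x in Set.Iic t, gaussianPDFReal 0 1 x := by
  rw [stdGaussianCDF, gaussianReal_apply_eq_integral 0 one_ne_zero,
    ENNReal.toReal_ofReal (integral_nonneg fun x => gaussianPDFReal_nonneg 0 1 x)]

theorem hasDerivAt_stdGaussianCDF (t : ℝ) :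
    HasDerivAt stdGaussianCDF (gaussianPDFReal 0 1 t) t := by
  have hcont : Continuous (gaussianPDFReal 0 1) := by
    unfold gaussianPDFReal
    fun_prop
  have hint := integrable_gaussianPDFReal 0 1
  have heq : stdGaussianCDF =
      fun u => stdGaussianCDF t + ∫ x in t..u, gaussianPDFReal 0 1 x := by
    funext u
    rw [stdGaussianCDF_eq_integral, stdGaussianCDF_eq_integral,
      ← intervalIntegral.integral_Iic_sub_Iic hint.integrableOn hint.integrableOn]
    ring
  rw [heq]
  exact (intervalIntegral.integral_hasDerivAt_right hint.intervalIntegrable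
    hcont.aestronglyMeasurable.stronglyMeasurableAtFilter hcont.continuousAt).const_add _

theorem continuous_stdGaussianCDF : Continuous stdGaussianCDF :=
  continuous_iff_continuousAt.2 fun t => (hasDerivAt_stdGaussianCDF t).continuousAt

theorem strictMono_stdGaussianCDF : StrictMono stdGaussianCDF :=
  strictMono_of_deriv_pos fun t => by
    rw [(hasDerivAt_stdGaussianCDF t).deriv]
    exact gaussianPDFReal_pos 0 1 t one_ne_zero

theorem tendsto_stdGaussianCDF_atTop :
    Filter.Tendsto stdGaussianCDF Filter.atTop (nhds 1) :=
  (tendsto_cdf_atTop (gaussianReal 0 1)).congr fun t => cdf_eq_real (gaussianReal 0 1) t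

theorem stdGaussianCDF_stdGaussianQuantile {a z : ℝ} (hz : z ∈ Set.Ico (stdGaussianCDF a) 1) :
    stdGaussianCDF (stdGaussianQuantile z) = z := by
  obtain ⟨c, hzc, hac⟩ := ((tendsto_stdGaussianCDF_atTop.eventually (lt_mem_nhds hz.2)).and
    (Filter.eventually_ge_atTop a)).exists
  obtain ⟨t, -, ht⟩ :=
    intermediate_value_Icc hac continuous_stdGaussianCDF.continuousOn ⟨hz.1, hzc.le⟩
  exact Function.invFun_eq ⟨t, ht⟩

theorem le_stdGaussianQuantile {a z : ℝ} (hz : z ∈ Set.Ico (stdGaussianCDF a) 1) :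
    a ≤ stdGaussianQuantile z := by
  rw [← strictMono_stdGaussianCDF.le_iff_le, stdGaussianCDF_stdGaussianQuantile hz]
  exact hz.1

theorem antitoneOn_mul_gaussianPDFReal :
    AntitoneOn (fun t => t * gaussianPDFReal 0 1 t) (Set.Ici 1) := by
  intro s (hs : 1 ≤ s) t (ht : 1 ≤ t) hst
  have hexp : t ≤ s * Real.exp ((t ^ 2 - s ^ 2) / 2) := by
    have := Real.add_one_le_exp ((t ^ 2 - s ^ 2) / 2)
    have hle : t - s + 1 ≤ Real.exp ((t ^ 2 - s ^ 2) / 2) := by nlinarith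
    nlinarith
  have hsplit : Real.exp (-s ^ 2 / 2) =
      Real.exp ((t ^ 2 - s ^ 2) / 2) * Real.exp (-t ^ 2 / 2) := by
    rw [← Real.exp_add]
    ring_nf
  have hmul : t * Real.exp (-t ^ 2 / 2) ≤ s * Real.exp (-s ^ 2 / 2) := by
    rw [hsplit, ← mul_assoc]
    exact mul_le_mul_of_nonneg_right hexp (Real.exp_pos _).le
  have hscale := mul_le_mul_of_nonneg_left hmul (inv_nonneg.2 (Real.sqrt_nonneg (2 * Real.pi)))
  simp only [gaussianPDFReal, NNReal.coe_one, mul_one, sub_zero]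
  linarith

/-- On `[1, ∞)`, the function `log t - Φ t / (q φ(q))` is minimal at `t = q`. -/
theorem log_sub_mul_stdGaussianCDF_le {q t : ℝ} (hq : 1 ≤ q) (ht : 1 ≤ t) :
    Real.log q - 1 / (q * gaussianPDFReal 0 1 q) * stdGaussianCDF q ≤
      Real.log t - 1 / (q * gaussianPDFReal 0 1 q) * stdGaussianCDF t := by
  set d := 1 / (q * gaussianPDFReal 0 1 q) with hd
  have hqpos : 0 < q * gaussianPDFReal 0 1 q :=
    mul_pos (by linarith) (gaussianPDFReal_pos 0 1 q one_ne_zero)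
  have hderiv : ∀ x : ℝ, 1 ≤ x → HasDerivAt (fun u => Real.log u - d * stdGaussianCDF u)
      (x⁻¹ - d * gaussianPDFReal 0 1 x) x := fun x hx =>
    (Real.hasDerivAt_log (by linarith)).sub ((hasDerivAt_stdGaussianCDF x).const_mul d)
  have hfactor : ∀ x : ℝ, 1 ≤ x → x⁻¹ - d * gaussianPDFReal 0 1 x =
      (q * gaussianPDFReal 0 1 q - x * gaussianPDFReal 0 1 x) *
        (x * (q * gaussianPDFReal 0 1 q))⁻¹ := fun x hx => by
    have hx0 : x ≠ 0 := by linarith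
    have hq0 : q ≠ 0 := by linarith
    have hpdf : gaussianPDFReal 0 1 q ≠ 0 := (gaussianPDFReal_pos 0 1 q one_ne_zero).ne'
    rw [hd]
    field_simp
  rcases le_total q t with hqt | htq
  · have hmono : MonotoneOn (fun u => Real.log u - d * stdGaussianCDF u) (Set.Icc q t) := by
      refine monotoneOn_of_deriv_nonneg (convex_Icc q t)
        (fun x hx => (hderiv x (hq.trans hx.1)).continuousAt.continuousWithinAt)
        (fun x hx => ?_) (fun x hx => ?_) <;> rw [interior_Icc] at hx <;>
        have hx1 : 1 ≤ x := hq.trans hx.1.le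
      · exact (hderiv x hx1).differentiableAt.differentiableWithinAt
      · rw [(hderiv x hx1).deriv, hfactor x hx1]
        exact mul_nonneg (sub_nonneg.2 (antitoneOn_mul_gaussianPDFReal hq hx1 hx.1.le))
          (by positivity)
    exact hmono (Set.left_mem_Icc.2 hqt) (Set.right_mem_Icc.2 hqt) hqt
  · have hanti : AntitoneOn (fun u => Real.log u - d * stdGaussianCDF u) (Set.Icc t q) := by
      refine antitoneOn_of_deriv_nonpos (convex_Icc t q)
        (fun x hx => (hderiv x (ht.trans hx.1)).continuousAt.continuousWithinAt)
        (fun x hx => ?_) (fun x hx => ?_) <;> rw [interior_Icc] at hx <;>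
        have hx1 : 1 ≤ x := ht.trans hx.1.le
      · exact (hderiv x hx1).differentiableAt.differentiableWithinAt
      · rw [(hderiv x hx1).deriv, hfactor x hx1]
        exact mul_nonpos_of_nonpos_of_nonneg
          (sub_nonpos.2 (antitoneOn_mul_gaussianPDFReal hx1 hq hx.2.le)) (by positivity)
    exact hanti (Set.left_mem_Icc.2 htq) (Set.right_mem_Icc.2 htq) htq

theorem stmt_11 (ξ : ℝ) (hξ : ξ ∈ Set.Ico (stdGaussianCDF 1) 1)
    (q₀ d b : ℝ) (hq₀ : q₀ = stdGaussianQuantile ξ)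
    (hd : d = 1 / (q₀ * ProbabilityTheory.gaussianPDFReal 0 1 q₀))
    (hb : b = Real.log q₀ - d * ξ) :
    ∀ z ∈ Set.Ico (stdGaussianCDF 1) 1,
      d * z + b ≤ Real.log (stdGaussianQuantile z) := by
  intro z hz
  have hmin := log_sub_mul_stdGaussianCDF_le (le_stdGaussianQuantile hξ)
    (le_stdGaussianQuantile hz)
  rw [stdGaussianCDF_stdGaussianQuantile hξ, stdGaussianCDF_stdGaussianQuantile hz,
    ← hq₀, ← hd] at hmin
  linarith
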